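/- arXiv:1510.06946 — 3 statements merged into one kernel-verified Lean document; each statement's English description precedes it below -/
import Mathlib

section
/- Let (X_t)_{t∈ℤ} be a strictly stationary ℝ^d-valued process that is exponentially α-mixing: there exist K < ∞ and κ ∈ (0,1) such that α(n) := sup |P(A ∩ B) − P(A)P(B)| ≤ K κⁿ for all n ∈ ℕ, where the supremum is over A in the σ-algebra generated by (X_0, X_{−1}, …) and B in the σ-algebra generated by (X_n, X_{n+1}, …). Then for every p ∈ ℕ there exist constants ρ ∈ (0,1) and K' < ∞ such that for arbitrary intervals A_1, …, A_p ⊂ ℝ, arbitrary indices j_1, …, j_p ∈ {1, …, d} and times t_1, …, t_p ∈ ℤ: |cum(I{X_{t_1,j_1} ∈ A_1}, …, I{X_{t_p,j_p} ∈ A_p})| ≤ K' ρ^{max_{i,j} |t_i − t_j|}. -/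
open MeasureTheory

noncomputable section

open scoped Classical in
/-- Real-valued indicator of a proposition. -/
def indR (p : Prop) : ℝ := if p then 1 else 0

open scoped Classical in
/-- The joint cumulant `cum(Z_1, …, Z_p)` of a finite family of real random variables,
defined by the sum over all partitions of `{1, …, p}`. -/
def cum {Ω : Type*} [MeasurableSpace Ω] (μ : Measure Ω)
    {p : ℕ} (Z : Fin p → Ω → ℝ) : ℝ :=
  ∑ P ∈ Finset.univ.filter
      (fun P : Finset (Finset (Fin p)) =>
        (∀ b ∈ P, b.Nonempty) ∧
        (P : Set (Finset (Fin p))).PairwiseDisjoint id ∧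
        P.sup id = Finset.univ),
    (-1 : ℝ) ^ (P.card - 1) * ((P.card - 1).factorial : ℝ) *
      ∏ b ∈ P, ∫ ω, (∏ i ∈ b, Z i ω) ∂μ

/-- The maximal pairwise gap `max_{i,j} |t_i - t_j|` of a tuple of times. -/
def maxGap {p : ℕ} (t : Fin p → ℤ) : ℕ :=
  Finset.univ.sup fun ij : Fin p × Fin p => (t ij.1 - t ij.2).natAbs

end

section Combinatorics

variable {α : Type*} [DecidableEq α]

/-- `P` is a partition of the finite set `S` into nonempty blocks. -/
def IsSetPartition (S : Finset α) (P : Finset (Finset α)) : Prop :=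
  (∀ b ∈ P, b.Nonempty) ∧ (P : Set (Finset α)).PairwiseDisjoint id ∧ P.sup id = S

theorem IsSetPartition.subset {S : Finset α} {P : Finset (Finset α)} (h : IsSetPartition S P)
    {b : Finset α} (hb : b ∈ P) : b ⊆ S := by
  rw [← h.2.2]
  exact Finset.le_sup (f := id) hb

theorem IsSetPartition.nonempty {S : Finset α} {P : Finset (Finset α)} (h : IsSetPartition S P)
    (hS : S.Nonempty) : P.Nonempty := by
  rw [Finset.nonempty_iff_ne_empty]
  rintro rfl
  have := h.2.2
  simp at this
  simp [← this] at hS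

theorem IsSetPartition.erase {S : Finset α} {Q : Finset (Finset α)} (h : IsSetPartition S Q)
    {B : Finset α} (hB : B ∈ Q) : IsSetPartition (S \ B) (Q.erase B) := by
  refine ⟨fun b hb => h.1 b (Finset.mem_of_mem_erase hb), ?_, ?_⟩
  · exact h.2.1.subset (by simp)
  · ext x
    rw [← h.2.2]
    simp only [Finset.mem_sup, Finset.mem_sdiff, Finset.mem_erase, id]
    constructor
    · rintro ⟨v, ⟨hv, hvQ⟩, hx⟩
      exact ⟨⟨v, hvQ, hx⟩, fun hxB =>
        Finset.disjoint_left.1 (h.2.1 hvQ hB hv) hx hxB⟩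
    · rintro ⟨⟨v, hvQ, hx⟩, hxB⟩
      exact ⟨v, ⟨fun e => hxB (e ▸ hx), hvQ⟩, hx⟩

theorem IsSetPartition.sdiff_notMem {S T : Finset α} {P : Finset (Finset α)}
    (h : IsSetPartition T P) : S \ T ∉ P := by
  intro hmem
  obtain ⟨x, hx⟩ := h.1 _ hmem
  exact (Finset.mem_sdiff.1 hx).2 (h.subset hmem hx)

theorem IsSetPartition.insert_sdiff {S T : Finset α} {P : Finset (Finset α)}
    (h : IsSetPartition T P) (hTS : T ⊂ S) : IsSetPartition S (insert (S \ T) P) := by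
  refine ⟨?_, ?_, ?_⟩
  · intro b hb
    rcases Finset.mem_insert.1 hb with rfl | hb
    · exact Finset.sdiff_nonempty.2 hTS.2
    · exact h.1 b hb
  · rw [Finset.coe_insert]
    refine h.2.1.insert fun b hb _ => ?_
    exact Finset.disjoint_left.2 fun x hx hxb =>
      (Finset.mem_sdiff.1 hx).2 (h.subset hb hxb)
  · rw [Finset.sup_insert, h.2.2]
    exact Finset.sdiff_union_of_subset hTS.1

theorem IsSetPartition.card_filter_notMem {S : Finset α} {Q : Finset (Finset α)}
    (h : IsSetPartition S Q) {a : α} (ha : a ∈ S) :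
    (Q.filter fun B => a ∉ B).card = Q.card - 1 := by
  have h1 : (Q.filter fun B => a ∈ B).card = 1 := by
    have ha' := ha
    rw [← h.2.2, Finset.mem_sup] at ha'
    obtain ⟨B, hB, haB⟩ := ha'
    rw [Finset.card_eq_one]
    refine ⟨B, Finset.ext fun C => ?_⟩
    rw [Finset.mem_filter, Finset.mem_singleton]
    constructor
    · rintro ⟨hC, haC⟩
      by_contra hne
      exact Finset.disjoint_left.1 (h.2.1 hC hB hne) haC haB
    · rintro rfl
      exact ⟨hB, haB⟩
  have := Finset.card_filter_add_card_filter_not (s := Q) (fun B => a ∈ B)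
  omega

variable [Fintype α]

open scoped Classical in
/-- The finite set of all partitions of `S`. -/
noncomputable def setPartitions (S : Finset α) : Finset (Finset (Finset α)) :=
  Finset.univ.filter fun P => IsSetPartition S P

theorem mem_setPartitions {S : Finset α} {P : Finset (Finset α)} :
    P ∈ setPartitions S ↔ IsSetPartition S P := by
  simp [setPartitions]

/-- The signed weight `(-1)^(k-1) (k-1)!` of a partition with `k` blocks. -/
noncomputable def cumulantWeight (k : ℕ) : ℝ := (-1) ^ (k - 1) * ((k - 1).factorial : ℝ)

/-- The cumulant on `S` attached to a family `h` of joint moments. -/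
noncomputable def momentCumulant (h : Finset α → ℝ) (S : Finset α) : ℝ :=
  ∑ P ∈ setPartitions S, cumulantWeight P.card * ∏ b ∈ P, h b

theorem sum_ssubset_setPartitions (h : Finset α → ℝ) (S : Finset α) {a : α} (ha : a ∈ S) :
    ∑ T ∈ S.ssubsets.filter (fun T => a ∈ T), momentCumulant h T * h (S \ T) =
      ∑ Q ∈ setPartitions S, ∑ _B ∈ Q.filter (fun B => a ∉ B),
        cumulantWeight (Q.card - 1) * ∏ b ∈ Q, h b := by
  simp only [momentCumulant, Finset.sum_mul]
  rw [Finset.sum_sigma', Finset.sum_sigma']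
  refine Finset.sum_bij' (fun x _ => ⟨insert (S \ x.1) x.2, S \ x.1⟩)
    (fun y _ => ⟨S \ y.2, y.1.erase y.2⟩) ?_ ?_ ?_ ?_ ?_
  · rintro ⟨T, P⟩ hx
    simp only [Finset.mem_sigma, Finset.mem_filter, Finset.mem_ssubsets,
      mem_setPartitions] at hx ⊢
    exact ⟨hx.2.insert_sdiff hx.1.1, Finset.mem_insert_self _ _, by simp [hx.1.2]⟩
  · rintro ⟨Q, B⟩ hy
    simp only [Finset.mem_sigma, Finset.mem_filter, Finset.mem_ssubsets,
      mem_setPartitions] at hy ⊢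
    exact ⟨⟨Finset.sdiff_ssubset (hy.1.subset hy.2.1) (hy.1.1 _ hy.2.1),
      Finset.mem_sdiff.2 ⟨ha, hy.2.2⟩⟩, hy.1.erase hy.2.1⟩
  · rintro ⟨T, P⟩ hx
    simp only [Finset.mem_sigma, Finset.mem_filter, Finset.mem_ssubsets,
      mem_setPartitions] at hx
    simp only [Sigma.mk.injEq, heq_eq_eq]
    exact ⟨Finset.sdiff_sdiff_eq_self hx.1.1.1,
      Finset.erase_insert (hx.2.sdiff_notMem (S := S))⟩
  · rintro ⟨Q, B⟩ hy
    simp only [Finset.mem_sigma, Finset.mem_filter, mem_setPartitions] at hy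
    have hB : S \ (S \ B) = B := Finset.sdiff_sdiff_eq_self (hy.1.subset hy.2.1)
    simp only [hB, Finset.insert_erase hy.2.1]
  · rintro ⟨T, P⟩ hx
    simp only [Finset.mem_sigma, Finset.mem_filter, Finset.mem_ssubsets,
      mem_setPartitions] at hx
    have hn := hx.2.sdiff_notMem (S := S)
    simp only [Finset.prod_insert hn, Finset.card_insert_of_notMem hn, Nat.add_sub_cancel]
    ring

/-- The moment-cumulant recursion relative to a distinguished element. -/
theorem momentCumulant_add_sum (h : Finset α → ℝ) (S : Finset α) {a : α} (ha : a ∈ S) :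
    momentCumulant h S +
      ∑ T ∈ S.ssubsets.filter (fun T => a ∈ T), momentCumulant h T * h (S \ T) = h S := by
  rw [sum_ssubset_setPartitions h S ha, momentCumulant, ← Finset.sum_add_distrib]
  have hS : IsSetPartition S {S} :=
    ⟨by simpa using ⟨a, ha⟩, by simp, by simp⟩
  rw [Finset.sum_eq_single_of_mem {S} (mem_setPartitions.2 hS)]
  · have h0 : ({S} : Finset (Finset α)).filter (fun B => a ∉ B) = ∅ := by
      simp [Finset.filter_singleton, ha]
    simp [h0, cumulantWeight]
  · intro Q hQ hne
    rw [mem_setPartitions] at hQ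
    rw [Finset.sum_const, hQ.card_filter_notMem ha, nsmul_eq_mul, ← mul_assoc, ← add_mul]
    have h2 : 2 ≤ Q.card := by
      have h1 := (hQ.nonempty ⟨a, ha⟩).card_pos
      by_contra hlt
      obtain ⟨B, rfl⟩ := Finset.card_eq_one.1 (show Q.card = 1 by omega)
      have := hQ.2.2
      simp at this
      exact hne (by rw [this])
    obtain ⟨k, hk⟩ := Nat.exists_eq_add_of_le h2
    have : 2 + k - 1 = k + 1 := by omega
    simp only [cumulantWeight, hk, this, Nat.add_sub_cancel, Nat.factorial_succ]
    push_cast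
    ring

/-- Cumulants vanish on sets meeting both parts of a splitting along which the moments
factorize. -/
theorem momentCumulant_eq_zero_of_factor (f : Finset α → ℝ) (h0 : f ∅ = 1)
    (I : Finset α) {a : α} (haI : a ∈ I) (S : Finset α) (haS : a ∈ S) (hS : ¬ S ⊆ I) :
    momentCumulant (fun b => f (b ∩ I) * f (b \ I)) S = 0 := by
  set h : Finset α → ℝ := fun b => f (b ∩ I) * f (b \ I) with hh
  induction S using Finset.strongInduction with
  | H S ih =>
    have hrec := momentCumulant_add_sum h S haS
    have haSI : a ∈ S ∩ I := Finset.mem_inter.2 ⟨haS, haI⟩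
    have hrecI := momentCumulant_add_sum h (S ∩ I) haSI
    have hss : S ∩ I ⊂ S := by
      refine ⟨Finset.inter_subset_left, fun hle => hS fun x hx => ?_⟩
      exact (Finset.mem_inter.1 (hle hx)).2
    have hsum : ∑ T ∈ S.ssubsets.filter (fun T => a ∈ T), momentCumulant h T * h (S \ T) =
        f (S \ I) * ∑ T ∈ (S ∩ I).powerset.filter (fun T => a ∈ T),
          momentCumulant h T * h ((S ∩ I) \ T) := by
      rw [Finset.mul_sum]
      symm
      refine Finset.sum_subset_zero_on_sdiff ?_ ?_ ?_
      · intro T hT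
        simp only [Finset.mem_filter, Finset.mem_powerset, Finset.mem_ssubsets] at hT ⊢
        exact ⟨hT.1.trans_ssubset hss, hT.2⟩
      · intro T hT
        simp only [Finset.mem_sdiff, Finset.mem_filter, Finset.mem_powerset,
          Finset.mem_ssubsets] at hT
        rw [ih T hT.1.1 hT.1.2 fun hTI =>
          hT.2 ⟨Finset.subset_inter hT.1.1.1 hTI, hT.1.2⟩, zero_mul]
      · intro T hT
        simp only [Finset.mem_filter, Finset.mem_powerset] at hT
        have hTI : T ⊆ I := hT.1.trans Finset.inter_subset_right
        have e1 : ((S ∩ I) \ T) ∩ I = (S \ T) ∩ I := by grind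
        have e2 : ((S ∩ I) \ T) \ I = ∅ := by grind
        have e3 : (S \ T) \ I = S \ I := by grind
        simp only [hh, e1, e2, e3, h0]
        ring
    have hpow : ∑ T ∈ (S ∩ I).powerset.filter (fun T => a ∈ T),
          momentCumulant h T * h ((S ∩ I) \ T) = f (S ∩ I) := by
      have hins : (S ∩ I).powerset.filter (fun T => a ∈ T) =
          insert (S ∩ I) ((S ∩ I).ssubsets.filter (fun T => a ∈ T)) := by
        ext T
        simp only [Finset.mem_filter, Finset.mem_powerset, Finset.mem_insert,
          Finset.mem_ssubsets]
        constructor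
        · rintro ⟨h1, h2⟩
          rcases h1.eq_or_ssubset with h1 | h1
          · exact Or.inl h1
          · exact Or.inr ⟨h1, h2⟩
        · rintro (rfl | ⟨h1, h2⟩)
          · exact ⟨subset_rfl, haSI⟩
          · exact ⟨h1.1, h2⟩
      have e0 : h ∅ = 1 := by simp [hh, h0]
      have e1 : h (S ∩ I) = f (S ∩ I) := by
        have e2 : (S ∩ I) \ I = ∅ := by grind
        have e3 : (S ∩ I) ∩ I = S ∩ I := by grind
        simp only [hh, e2, e3, h0, mul_one]
      rw [hins, Finset.sum_insert (by simp), Finset.sdiff_self, e0, mul_one, hrecI, e1]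
    rw [hsum, hpow] at hrec
    have : h S = f (S ∩ I) * f (S \ I) := rfl
    linarith

theorem abs_prod_sub_prod_le {ι : Type*} [DecidableEq ι] (s : Finset ι) (u v : ι → ℝ) {ε : ℝ}
    (hu : ∀ i, |u i| ≤ 1) (hv : ∀ i, |v i| ≤ 1) (huv : ∀ i, |u i - v i| ≤ ε) :
    |∏ i ∈ s, u i - ∏ i ∈ s, v i| ≤ s.card * ε := by
  induction s using Finset.induction_on with
  | empty => simp
  | insert i s hi ih =>
    rw [Finset.prod_insert hi, Finset.prod_insert hi, Finset.card_insert_of_notMem hi]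
    have hp : |∏ i ∈ s, u i| ≤ 1 := by
      rw [Finset.abs_prod]
      exact Finset.prod_le_one (fun _ _ => abs_nonneg _) fun i _ => hu i
    have e : u i * ∏ i ∈ s, u i - v i * ∏ i ∈ s, v i =
        (u i - v i) * ∏ i ∈ s, u i + v i * (∏ i ∈ s, u i - ∏ i ∈ s, v i) := by ring
    rw [e]
    refine (abs_add_le _ _).trans ?_
    rw [abs_mul, abs_mul]
    have h1 := mul_le_mul (huv i) hp (abs_nonneg _) ((abs_nonneg _).trans (huv i))
    have h2 := mul_le_mul (hv i) ih (abs_nonneg _) zero_le_one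
    push_cast
    linarith

theorem abs_momentCumulant_sub_le (u v : Finset α → ℝ) (S : Finset α) {ε : ℝ}
    (hu : ∀ b, |u b| ≤ 1) (hv : ∀ b, |v b| ≤ 1) (huv : ∀ b, |u b - v b| ≤ ε) :
    |momentCumulant u S - momentCumulant v S| ≤
      (∑ P ∈ setPartitions S, |cumulantWeight P.card| * P.card) * ε := by
  rw [momentCumulant, momentCumulant, ← Finset.sum_sub_distrib, Finset.sum_mul]
  refine (Finset.abs_sum_le_sum_abs _ _).trans (Finset.sum_le_sum fun P _ => ?_)
  rw [← mul_sub, abs_mul, mul_assoc]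
  exact mul_le_mul_of_nonneg_left (abs_prod_sub_prod_le P u v hu hv huv) (abs_nonneg _)

theorem abs_momentCumulant_le (u : Finset α → ℝ) (S : Finset α) (hu : ∀ b, |u b| ≤ 1) :
    |momentCumulant u S| ≤ ∑ P ∈ setPartitions S, |cumulantWeight P.card| := by
  refine (Finset.abs_sum_le_sum_abs _ _).trans (Finset.sum_le_sum fun P _ => ?_)
  rw [abs_mul, Finset.abs_prod]
  exact mul_le_of_le_one_right (abs_nonneg _)
    (Finset.prod_le_one (fun _ _ => abs_nonneg _) fun i _ => hu i)

end Combinatorics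

theorem exists_maxGap_eq {p : ℕ} (hp : 0 < p) (t : Fin p → ℤ) :
    ∃ a b, t b - t a = maxGap t := by
  have : Nonempty (Fin p × Fin p) := ⟨⟨⟨0, hp⟩, ⟨0, hp⟩⟩⟩
  obtain ⟨⟨i, j⟩, -, hij⟩ := Finset.exists_mem_eq_sup (Finset.univ : Finset (Fin p × Fin p))
    Finset.univ_nonempty fun ij => (t ij.1 - t ij.2).natAbs
  rw [maxGap, hij]
  rcases le_total (t j) (t i) with h | h
  · exact ⟨j, i, by dsimp only; omega⟩
  · exact ⟨i, j, by dsimp only; omega⟩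

/-- If the times `t` spread over more than `p * n`, then some time is separated from all
earlier ones by a gap larger than `n`. -/
theorem exists_gap {p : ℕ} (t : Fin p → ℤ) (n : ℕ) {a b : Fin p}
    (hab : (p : ℤ) * n < t b - t a) :
    ∃ i, t a < t i ∧ ∀ j, t j < t i → t j + n < t i := by
  by_contra! hcon
  have key : ∀ N : ℕ, ∀ i, (Finset.univ.filter fun l => t l < t i).card = N →
      t i - t a ≤ N * n := by
    intro N
    induction N using Nat.strong_induction_on with
    | _ N ih =>
      intro i hi
      rcases le_or_gt (t i) (t a) with h | h
      · have : (0 : ℤ) ≤ N * n := by positivity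
        linarith
      · obtain ⟨j, hj, hjn⟩ := hcon i h
        have hlt : (Finset.univ.filter fun l => t l < t j).card < N := by
          rw [← hi]
          refine Finset.card_lt_card ⟨fun l hl => ?_, fun hle => ?_⟩
          · simp only [Finset.mem_filter, Finset.mem_univ, true_and] at hl ⊢
            exact hl.trans hj
          · have := hle (Finset.mem_filter.2 ⟨Finset.mem_univ j, hj⟩)
            simp at this
        have h1 := ih _ hlt j rfl
        have h2 : (((Finset.univ.filter fun l => t l < t j).card : ℤ) + 1) * n ≤ N * n :=
          mul_le_mul_of_nonneg_right (by exact_mod_cast hlt) (by positivity)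
        linarith
  have h1 := key _ b rfl
  have h2 : (Finset.univ.filter fun l => t l < t b).card ≤ p := by
    simpa using Finset.card_le_univ (Finset.univ.filter fun l => t l < t b)
  have h3 : ((Finset.univ.filter fun l => t l < t b).card : ℤ) * n ≤ p * n :=
    mul_le_mul_of_nonneg_right (by exact_mod_cast h2) (by positivity)
  linarith

theorem measurableSet_biInter_preimage {Ω : Type*} {d : ℕ} {X : ℤ → Ω → Fin d → ℝ}
    {p : ℕ} (q : ℤ → Prop) (t : Fin p → ℤ) (j : Fin p → Fin d)
    (A : Fin p → Set ℝ) (hA : ∀ i, MeasurableSet (A i)) (b : Finset (Fin p))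
    (hb : ∀ i ∈ b, q (t i)) :
    MeasurableSet[⨆ (s : ℤ) (_ : q s), MeasurableSpace.comap (X s) inferInstance]
      (⋂ i ∈ b, {ω | X (t i) ω (j i) ∈ A i}) := by
  refine Finset.measurableSet_biInter b fun i hi => ?_
  have hle : MeasurableSpace.comap (X (t i)) inferInstance ≤
      ⨆ (s : ℤ) (_ : q s), MeasurableSpace.comap (X s) inferInstance :=
    le_iSup₂_of_le (t i) (hb i hi) le_rfl
  exact hle _ ⟨{x | x (j i) ∈ A i}, measurable_pi_apply (j i) (hA i), rfl⟩

section Mixing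

variable {Ω : Type*} [MeasurableSpace Ω] {μ : Measure Ω}

theorem cum_eq_momentCumulant {p : ℕ} (Z : Fin p → Ω → ℝ) :
    cum μ Z = momentCumulant (fun b => ∫ ω, ∏ i ∈ b, Z i ω ∂μ) Finset.univ := by
  unfold cum momentCumulant cumulantWeight
  refine Finset.sum_congr ?_ fun _ _ => rfl
  classical
  ext P
  rw [mem_setPartitions, IsSetPartition]
  exact Finset.mem_filter_univ P

theorem integral_prod_indR {ι : Type*} (b : Finset ι) (E : ι → Set Ω)
    (hE : ∀ i, MeasurableSet (E i)) :
    ∫ ω, ∏ i ∈ b, indR (ω ∈ E i) ∂μ = (μ (⋂ i ∈ b, E i)).toReal := by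
  have hmeas : MeasurableSet (⋂ i ∈ b, E i) := Finset.measurableSet_biInter b fun i _ => hE i
  rw [← measureReal_def, ← integral_indicator_one hmeas]
  refine integral_congr_ae (Filter.Eventually.of_forall fun ω => ?_)
  by_cases hω : ω ∈ ⋂ i ∈ b, E i
  · have h : ∀ i ∈ b, ω ∈ E i := by simpa using hω
    simp only [Set.indicator_of_mem hω, Pi.one_apply]
    exact Finset.prod_eq_one fun i hi => by simp [indR, h i hi]
  · have h : ∃ i ∈ b, ω ∉ E i := by simpa using hω
    obtain ⟨i, hi, hiE⟩ := h
    simp only [Set.indicator_of_notMem hω]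
    exact Finset.prod_eq_zero hi (by simp [indR, hiE])

theorem measurable_indR_mem {β : Type*} [MeasurableSpace β] {s : Set β} (hs : MeasurableSet s) :
    Measurable fun x => indR (x ∈ s) := by
  classical
  exact Measurable.ite hs measurable_const measurable_const

variable {d : ℕ} {X : ℤ → Ω → Fin d → ℝ}

theorem cum_shift (hmeas : ∀ t, Measurable (X t)) {p : ℕ} (t : Fin p → ℤ) (k : ℤ)
    (hstat : Measure.map (fun ω => fun i => X (t i + k) ω) μ =
      Measure.map (fun ω => fun i => X (t i) ω) μ)
    (j : Fin p → Fin d) (A : Fin p → Set ℝ) (hA : ∀ i, MeasurableSet (A i)) :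
    cum μ (fun i ω => indR (X (t i + k) ω (j i) ∈ A i)) =
      cum μ (fun i ω => indR (X (t i) ω (j i) ∈ A i)) := by
  rw [cum_eq_momentCumulant, cum_eq_momentCumulant]
  congr 1
  funext b
  have hφ : Measurable fun x : Fin p → Fin d → ℝ => ∏ i ∈ b, indR (x i (j i) ∈ A i) :=
    Finset.measurable_prod b fun i _ =>
      (measurable_indR_mem (hA i)).comp ((measurable_pi_apply (j i)).comp (measurable_pi_apply i))
  have h1 := integral_map (μ := μ) (φ := fun ω => fun i => X (t i + k) ω)
    (measurable_pi_lambda _ fun i => hmeas _).aemeasurable hφ.aestronglyMeasurable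
  have h2 := integral_map (μ := μ) (φ := fun ω => fun i => X (t i) ω)
    (measurable_pi_lambda _ fun i => hmeas _).aemeasurable hφ.aestronglyMeasurable
  rw [← h1, ← h2, hstat]

/-- Cumulant bound for times separated into nonpositive ones and ones that are at least `n`. -/
theorem abs_cum_le_of_separated [IsProbabilityMeasure μ] (hmeas : ∀ t, Measurable (X t))
    {ε : ℝ} {n : ℕ}
    (hmix : ∀ A B : Set Ω,
      MeasurableSet[⨆ (t : ℤ) (_ : t ≤ 0), MeasurableSpace.comap (X t) inferInstance] A →
      MeasurableSet[⨆ (t : ℤ) (_ : (n : ℤ) ≤ t), MeasurableSpace.comap (X t) inferInstance] B →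
      |(μ (A ∩ B)).toReal - (μ A).toReal * (μ B).toReal| ≤ ε)
    {p : ℕ} (t : Fin p → ℤ) (ht : ∀ i, t i ≤ 0 ∨ (n : ℤ) ≤ t i)
    (hneg : ∃ i, t i ≤ 0) (hpos : ∃ i, 0 < t i)
    (j : Fin p → Fin d) (A : Fin p → Set ℝ) (hA : ∀ i, MeasurableSet (A i)) :
    |cum μ (fun i ω => indR (X (t i) ω (j i) ∈ A i))| ≤
      (∑ P ∈ setPartitions (Finset.univ : Finset (Fin p)),
        |cumulantWeight P.card| * P.card) * ε := by
  set E : Fin p → Set Ω := fun i => {ω | X (t i) ω (j i) ∈ A i}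
  have hE : ∀ i, MeasurableSet (E i) := fun i =>
    ((measurable_pi_apply (j i)).comp (hmeas (t i))) (hA i)
  set f : Finset (Fin p) → ℝ := fun b => (μ (⋂ i ∈ b, E i)).toReal with hf
  have hcum : cum μ (fun i ω => indR (X (t i) ω (j i) ∈ A i)) =
      momentCumulant f Finset.univ := by
    rw [cum_eq_momentCumulant]
    congr 1
    funext b
    exact integral_prod_indR b E hE
  have hf1 : ∀ b, |f b| ≤ 1 := fun b => by
    rw [abs_of_nonneg ENNReal.toReal_nonneg]
    exact measureReal_le_one
  set I : Finset (Fin p) := Finset.univ.filter fun i => t i ≤ 0 with hI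
  obtain ⟨a, ha⟩ := hneg
  obtain ⟨c, hc⟩ := hpos
  have hzero := momentCumulant_eq_zero_of_factor f (by simp [hf]) I (a := a) (by simp [hI, ha])
    Finset.univ (Finset.mem_univ a) (fun hsub => by
      have := hsub (Finset.mem_univ c)
      simp only [hI, Finset.mem_filter, Finset.mem_univ, true_and] at this
      omega)
  have hsub := abs_momentCumulant_sub_le f (fun b => f (b ∩ I) * f (b \ I)) Finset.univ
    (ε := ε) hf1 (fun b => by
      rw [abs_mul]
      exact mul_le_one₀ (hf1 _) (abs_nonneg _) (hf1 _)) (fun b => by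
      have h := hmix (⋂ i ∈ b ∩ I, E i) (⋂ i ∈ b \ I, E i)
        (measurableSet_biInter_preimage (fun s => s ≤ 0) t j A hA _ fun i hi => by
          simp only [hI, Finset.mem_inter, Finset.mem_filter] at hi
          exact hi.2.2)
        (measurableSet_biInter_preimage (fun s => (n : ℤ) ≤ s) t j A hA _ fun i hi => by
          simp only [hI, Finset.mem_sdiff, Finset.mem_filter, Finset.mem_univ, true_and] at hi
          exact (ht i).resolve_left hi.2)
      have hinter : (⋂ i ∈ b ∩ I, E i) ∩ (⋂ i ∈ b \ I, E i) = ⋂ i ∈ b, E i := by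
        rw [← Finset.set_biInter_inter, Finset.union_comm, Finset.sdiff_union_inter]
      rwa [hinter] at h)
  rwa [hzero, sub_zero, ← hcum] at hsub

theorem abs_cum_indR_le [IsProbabilityMeasure μ] (hmeas : ∀ t, Measurable (X t))
    {p : ℕ} (t : Fin p → ℤ) (j : Fin p → Fin d) (A : Fin p → Set ℝ)
    (hA : ∀ i, MeasurableSet (A i)) :
    |cum μ (fun i ω => indR (X (t i) ω (j i) ∈ A i))| ≤
      ∑ P ∈ setPartitions (Finset.univ : Finset (Fin p)), |cumulantWeight P.card| := by
  rw [cum_eq_momentCumulant]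
  refine abs_momentCumulant_le _ _ fun b => ?_
  have := integral_prod_indR (μ := μ) b (fun i => {ω | X (t i) ω (j i) ∈ A i}) fun i =>
    ((measurable_pi_apply (j i)).comp (hmeas (t i))) (hA i)
  simp only [Set.mem_ofPred_eq] at this
  rw [this, abs_of_nonneg ENNReal.toReal_nonneg]
  exact measureReal_le_one

end Mixing

/-- Exponential α-mixing of a strictly stationary process implies the cumulant bound
(Assumption (C)): for every `p` there are `ρ ∈ (0,1)` and `K' < ∞` such that the joint
cumulants of indicators of the process hitting intervals decay geometrically in the
maximal time gap. -/
theorem alpha_mixing_implies_indicator_cumulant_bound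
    {Ω : Type*} [MeasurableSpace Ω] (μ : Measure Ω) [IsProbabilityMeasure μ]
    {d : ℕ} (X : ℤ → Ω → Fin d → ℝ) (hmeas : ∀ t, Measurable (X t))
    (hstat : ∀ (k : ℤ) (m : ℕ) (ts : Fin m → ℤ),
      Measure.map (fun ω => fun i => X (ts i + k) ω) μ =
        Measure.map (fun ω => fun i => X (ts i) ω) μ)
    (K κ : ℝ) (hκ : κ ∈ Set.Ioo (0 : ℝ) 1)
    (hmix : ∀ (n : ℕ) (A B : Set Ω),
      MeasurableSet[⨆ (t : ℤ) (_ : t ≤ 0), MeasurableSpace.comap (X t) inferInstance] A →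
      MeasurableSet[⨆ (t : ℤ) (_ : (n : ℤ) ≤ t), MeasurableSpace.comap (X t) inferInstance] B →
      |(μ (A ∩ B)).toReal - (μ A).toReal * (μ B).toReal| ≤ K * κ ^ n) :
    ∀ p : ℕ, ∃ ρ ∈ Set.Ioo (0 : ℝ) 1, ∃ K' : ℝ,
      ∀ (t : Fin p → ℤ) (j : Fin p → Fin d) (A : Fin p → Set ℝ),
        (∀ i, (A i).OrdConnected) →
        |cum μ (fun i ω => indR (X (t i) ω (j i) ∈ A i))| ≤ K' * ρ ^ maxGap t := by
  intro p
  have hK : 0 ≤ K := by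
    have := (abs_nonneg _).trans (hmix 0 ∅ ∅ (MeasurableSpace.measurableSet_empty _)
      (MeasurableSpace.measurableSet_empty _))
    simpa using this
  set C₀ : ℝ := ∑ P ∈ setPartitions (Finset.univ : Finset (Fin p)), |cumulantWeight P.card|
  set C₁ : ℝ := ∑ P ∈ setPartitions (Finset.univ : Finset (Fin p)),
    |cumulantWeight P.card| * P.card
  have hC₀ : 0 ≤ C₀ := Finset.sum_nonneg fun _ _ => abs_nonneg _
  have hC₁ : 0 ≤ C₁ := Finset.sum_nonneg fun _ _ => by positivity
  rcases Nat.eq_zero_or_pos p with rfl | hp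
  · refine ⟨κ, hκ, C₀, fun t j A hA => ?_⟩
    have : maxGap t = 0 := by simp [maxGap]
    rw [this, pow_zero, mul_one]
    exact abs_cum_indR_le hmeas t j A fun i => (hA i).measurableSet
  set ρ : ℝ := κ ^ ((p : ℝ)⁻¹)
  have hρ0 : 0 < ρ := Real.rpow_pos_of_pos hκ.1 _
  have hρ1 : ρ < 1 := Real.rpow_lt_one hκ.1.le hκ.2 (by positivity)
  have hρp : ρ ^ p = κ := Real.rpow_inv_natCast_pow hκ.1.le hp.ne'
  refine ⟨ρ, ⟨hρ0, hρ1⟩, C₀ + C₁ * K, fun t j A hA => ?_⟩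
  have hA' : ∀ i, MeasurableSet (A i) := fun i => (hA i).measurableSet
  rcases Nat.eq_zero_or_pos (maxGap t) with h0 | hT
  · rw [h0, pow_zero, mul_one]
    exact (abs_cum_indR_le hmeas t j A hA').trans (le_add_of_nonneg_right (mul_nonneg hC₁ hK))
  obtain ⟨a, b, hab⟩ := exists_maxGap_eq hp t
  obtain ⟨m, hm⟩ : ∃ m, m = (maxGap t - 1) / p := ⟨_, rfl⟩
  have hlt : p * m < maxGap t := by
    have : p * m ≤ maxGap t - 1 := hm ▸ Nat.mul_div_le (maxGap t - 1) p
    omega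
  have hle : maxGap t ≤ p * (m + 1) := by
    have : maxGap t - 1 < p * (m + 1) := hm ▸ Nat.lt_mul_div_succ (maxGap t - 1) hp
    omega
  obtain ⟨i₀, hai, hgap⟩ := exists_gap t m (a := a) (b := b) (by
    rw [hab]
    exact_mod_cast hlt)
  obtain ⟨k, hk⟩ : ∃ k : ℤ, k = m + 1 - t i₀ := ⟨_, rfl⟩
  rw [← cum_shift hmeas t k (hstat k p t) j A hA']
  have hbound := abs_cum_le_of_separated hmeas (ε := K * κ ^ (m + 1)) (n := m + 1)
    (hmix (m + 1)) (fun i => t i + k)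
    (fun i => by
      rcases lt_or_ge (t i) (t i₀) with h | h
      · have := hgap i h
        left
        omega
      · right
        push_cast
        omega)
    ⟨a, by have := hgap a hai; omega⟩ ⟨i₀, by omega⟩ j A hA'
  refine hbound.trans ?_
  have hpow : κ ^ (m + 1) ≤ ρ ^ maxGap t := by
    rw [← hρp, ← pow_mul]
    exact pow_le_pow_of_le_one hρ0.le hρ1.le hle
  calc C₁ * (K * κ ^ (m + 1)) = C₁ * K * κ ^ (m + 1) := by ring
    _ ≤ (C₀ + C₁ * K) * ρ ^ maxGap t :=
      mul_le_mul (le_add_of_nonneg_left hC₀) hpow (pow_nonneg hκ.1.le _)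
        (add_nonneg hC₀ (mul_nonneg hC₁ hK))
end

section
/- For every ρ ∈ (0,1) and every u ∈ ℕ₀ there exists a constant C > 0 such that for all ε ∈ (0,1]: Σ_{m=0}^{∞} m^u · min(ρ^m, ε) ≤ C ε (1 + |log ε|)^{u+1}. -/
theorem summable_succ_pow_mul_geometric {ρ : ℝ} (h0 : 0 < ρ) (h1 : ρ < 1) (u : ℕ) :
    Summable fun m : ℕ => ((m : ℝ) + 1) ^ u * ρ ^ m := by
  have h : Summable fun m : ℕ => (m : ℝ) ^ u * ρ ^ m :=
    summable_pow_mul_geometric_of_norm_lt_one u (by rwa [Real.norm_of_nonneg h0.le])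
  refine (((summable_nat_add_iff 1).2 h).mul_left ρ⁻¹).congr fun m => ?_
  push_cast
  rw [pow_succ']
  field_simp

/-- The level `ε` is reached by `ρ ^ N` for some `N` of order `1 + |log ε|`. -/
theorem exists_pow_le_and_le_mul_one_add_abs_log {ρ ε : ℝ} (h0 : 0 < ρ) (h1 : ρ < 1)
    (hε : 0 < ε) :
    ∃ N : ℕ, ρ ^ N ≤ ε ∧ (N : ℝ) ≤ (1 + (-Real.log ρ)⁻¹) * (1 + |Real.log ε|) := by
  have ha : 0 < -Real.log ρ := neg_pos.2 (Real.log_neg h0 h1)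
  refine ⟨⌈|Real.log ε| / -Real.log ρ⌉₊, ?_, ?_⟩
  · rw [← Real.log_le_log_iff (pow_pos h0 _) hε, Real.log_pow]
    have h := (div_le_iff₀ ha).1 (Nat.le_ceil (|Real.log ε| / -Real.log ρ))
    linarith [neg_abs_le (Real.log ε)]
  · have h := Nat.ceil_lt_add_one (div_nonneg (abs_nonneg (Real.log ε)) ha.le)
    rw [div_eq_mul_inv] at h ⊢
    linarith [abs_nonneg (Real.log ε), inv_pos.2 ha]

/-- A split at an index `N` with `ρ ^ N ≤ ε` and `N ≤ M` bounds the weighted sum. -/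
theorem tsum_pow_mul_min_geometric_le {ρ ε M : ℝ} (h0 : 0 < ρ) (h1 : ρ < 1) (hε : 0 < ε)
    (u N : ℕ) (hN : ρ ^ N ≤ ε) (hNM : (N : ℝ) ≤ M) (hM : 1 ≤ M) :
    ∑' m : ℕ, (m : ℝ) ^ u * min (ρ ^ m) ε ≤
      ε * M ^ (u + 1) + ε * M ^ u * ∑' m : ℕ, ((m : ℝ) + 1) ^ u * ρ ^ m := by
  have hs : Summable fun m : ℕ => (m : ℝ) ^ u * min (ρ ^ m) ε := by
    refine Summable.of_nonneg_of_le (fun m => by positivity) (fun m => ?_)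
      (summable_succ_pow_mul_geometric h0 h1 u)
    gcongr
    · linarith
    · exact min_le_left _ _
  rw [← hs.sum_add_tsum_nat_add N]
  refine add_le_add ?_ ?_
  · calc ∑ m ∈ Finset.range N, (m : ℝ) ^ u * min (ρ ^ m) ε
        ≤ ∑ _m ∈ Finset.range N, M ^ u * ε := by
          refine Finset.sum_le_sum fun m hm => ?_
          have hmM : (m : ℝ) ≤ M :=
            (Nat.cast_le.2 (Finset.mem_range.1 hm).le).trans hNM
          gcongr
          exact min_le_right _ _
      _ = N * (M ^ u * ε) := by simp
      _ ≤ M * (M ^ u * ε) := by gcongr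
      _ = ε * M ^ (u + 1) := by ring
  · rw [← tsum_mul_left]
    refine Summable.tsum_le_tsum (fun m => ?_) ((summable_nat_add_iff N).2 hs)
      ((summable_succ_pow_mul_geometric h0 h1 u).mul_left _)
    have hmN : ((m + N : ℕ) : ℝ) ≤ M * (m + 1) := by
      push_cast
      nlinarith [(Nat.cast_nonneg m : (0 : ℝ) ≤ m)]
    calc ((m + N : ℕ) : ℝ) ^ u * min (ρ ^ (m + N)) ε
        ≤ (M * (m + 1)) ^ u * (ρ ^ m * ε) := by
          gcongr
          refine (min_le_left _ _).trans ?_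
          rw [pow_add]
          gcongr
      _ = ε * M ^ u * (((m : ℝ) + 1) ^ u * ρ ^ m) := by rw [mul_pow]; ring

/-- For every `ρ ∈ (0,1)` and `u ∈ ℕ` there is a constant `C > 0` such that for all
`ε ∈ (0,1]`, `Σ_{m=0}^∞ m^u min(ρ^m, ε) ≤ C ε (1 + |log ε|)^{u+1}`. -/
theorem geometric_vs_level_weighted_sum_bound
    (ρ : ℝ) (hρ : ρ ∈ Set.Ioo (0 : ℝ) 1) (u : ℕ) :
    ∃ C > (0 : ℝ), ∀ ε ∈ Set.Ioc (0 : ℝ) 1,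
      ∑' m : ℕ, (m : ℝ) ^ u * min (ρ ^ m) ε ≤ C * ε * (1 + |Real.log ε|) ^ (u + 1) := by
  obtain ⟨h0, h1⟩ := hρ
  have ha : 0 < (-Real.log ρ)⁻¹ := inv_pos.2 (neg_pos.2 (Real.log_neg h0 h1))
  have hS : 0 ≤ ∑' m : ℕ, ((m : ℝ) + 1) ^ u * ρ ^ m := tsum_nonneg fun m => by positivity
  set K := 1 + (-Real.log ρ)⁻¹
  set S := ∑' m : ℕ, ((m : ℝ) + 1) ^ u * ρ ^ m
  have hK : 1 ≤ K := le_add_of_nonneg_right ha.le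
  refine ⟨K ^ (u + 1) + K ^ u * S, by positivity, fun ε hε => ?_⟩
  have hε0 : 0 < ε := hε.1
  obtain ⟨N, hN, hNK⟩ := exists_pow_le_and_le_mul_one_add_abs_log h0 h1 hε0
  have hL : 1 ≤ 1 + |Real.log ε| := le_add_of_nonneg_right (abs_nonneg _)
  set L := 1 + |Real.log ε|
  calc ∑' m : ℕ, (m : ℝ) ^ u * min (ρ ^ m) ε
      ≤ ε * (K * L) ^ (u + 1) + ε * (K * L) ^ u * S :=
        tsum_pow_mul_min_geometric_le h0 h1 hε0 u N hN hNK (one_le_mul_of_one_le_of_one_le hK hL)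
    _ = ε * K ^ (u + 1) * L ^ (u + 1) + ε * K ^ u * S * L ^ u := by rw [mul_pow, mul_pow]; ring
    _ ≤ ε * K ^ (u + 1) * L ^ (u + 1) + ε * K ^ u * S * L ^ (u + 1) := by
        gcongr
        exact u.le_succ
    _ = (K ^ (u + 1) + K ^ u * S) * ε * L ^ (u + 1) := by ring
end

section
/- Let X be a standard normal random variable, let τ₁, τ₂ ∈ (0,1), let a := Φ^{-1}(τ₁) and b := Φ^{-1}((1+τ₂)/2), where Φ is the standard normal distribution function (so that P(X² ≤ b²) = τ₂). Then Cov(I{X ≤ a}, I{X² ≤ b²}) equals (1 − τ₂)(τ₁ − 1/2) if (1−τ₂)/2 ≤ τ₁ ≤ (1+τ₂)/2, equals τ₂(1 − τ₁) if τ₁ > (1+τ₂)/2, and equals −τ₁τ₂ if τ₁ < (1−τ₂)/2. In particular this covariance is zero for all τ₂ ∈ (0,1) if and only if τ₁ = 1/2, even though Cov(X, X²) = 0. -/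
open MeasureTheory ProbabilityTheory

noncomputable section

/-- Covariance of two real random variables. -/
def covP {Ω : Type*} [MeasurableSpace Ω] (μ : Measure Ω) (f g : Ω → ℝ) : ℝ :=
  (∫ ω, f ω * g ω ∂μ) - (∫ ω, f ω ∂μ) * (∫ ω, g ω ∂μ)

/-- The standard normal cumulative distribution function. -/
def stdPhi (x : ℝ) : ℝ := ((gaussianReal 0 1) (Set.Iic x)).toReal

end

lemma integral_indR_preimage {Ω α : Type*} [MeasurableSpace Ω] [MeasurableSpace α]
    {P : Measure Ω} {X : Ω → α} (hX : Measurable X) {S : Set α} (hS : MeasurableSet S) :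
    ∫ ω, indR (X ω ∈ S) ∂P = (P.map X).real S := by
  have h : (fun ω => indR (X ω ∈ S)) = (X ⁻¹' S).indicator 1 := by
    ext ω
    by_cases hω : X ω ∈ S <;> simp [indR, hω]
  rw [h, integral_indicator_one (hX hS), map_measureReal_apply hX hS]

lemma covP_indR_preimage {Ω α : Type*} [MeasurableSpace Ω] [MeasurableSpace α]
    {P : Measure Ω} {X : Ω → α} (hX : Measurable X) {S T : Set α}
    (hS : MeasurableSet S) (hT : MeasurableSet T) :
    covP P (fun ω => indR (X ω ∈ S)) (fun ω => indR (X ω ∈ T))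
      = (P.map X).real (S ∩ T) - (P.map X).real S * (P.map X).real T := by
  have h : (fun ω => indR (X ω ∈ S) * indR (X ω ∈ T)) = fun ω => indR (X ω ∈ S ∩ T) := by
    ext ω
    by_cases h₁ : X ω ∈ S <;> by_cases h₂ : X ω ∈ T <;> simp [indR, h₁, h₂]
  rw [covP, h, integral_indR_preimage hX (hS.inter hT), integral_indR_preimage hX hS,
    integral_indR_preimage hX hT]

lemma gaussianReal_real_Ioc {x y : ℝ} (h : x ≤ y) :
    (gaussianReal 0 1).real (Set.Ioc x y) = stdPhi y - stdPhi x := by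
  rw [← Set.Ioi_inter_Iic, Set.inter_comm, ← Set.compl_Iic, ← Set.sdiff_eq,
    measureReal_sdiff (Set.Iic_subset_Iic.2 h) measurableSet_Iic]
  rfl

lemma gaussianReal_real_Icc {x y : ℝ} (h : x ≤ y) :
    (gaussianReal 0 1).real (Set.Icc x y) = stdPhi y - stdPhi x := by
  have := nullSingletonClass_gaussianReal (μ := 0) one_ne_zero
  rw [← gaussianReal_real_Ioc h, measureReal_congr Ioc_ae_eq_Icc]

lemma stdPhi_strictMono : StrictMono stdPhi := by
  intro x y h
  have hpos : gaussianReal 0 1 (Set.Ioc x y) ≠ 0 := fun h₀ => by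
    have := gaussianReal_absolutelyContinuous' 0 one_ne_zero h₀
    rw [Real.volume_Ioc, ENNReal.ofReal_eq_zero] at this
    linarith
  have := gaussianReal_real_Ioc h.le
  have : 0 < (gaussianReal 0 1).real (Set.Ioc x y) :=
    ENNReal.toReal_pos hpos (measure_ne_top _ _)
  linarith

lemma stdPhi_neg (x : ℝ) : stdPhi (-x) = 1 - stdPhi x := by
  have := nullSingletonClass_gaussianReal (μ := 0) one_ne_zero
  have hmap : (gaussianReal 0 1).map (fun y => -y) = gaussianReal 0 1 := by
    simpa using gaussianReal_map_neg (μ := 0) (v := 1)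
  change (gaussianReal 0 1).real (Set.Iic (-x)) = 1 - (gaussianReal 0 1).real (Set.Iic x)
  rw [← probReal_compl_eq_one_sub measurableSet_Iic, Set.compl_Iic,
    measureReal_congr Ioi_ae_eq_Ici]
  nth_rw 1 [← hmap]
  rw [map_measureReal_apply measurable_neg measurableSet_Iic]
  simp

lemma stdPhi_zero : stdPhi 0 = 1 / 2 := by
  have := stdPhi_neg 0
  rw [neg_zero] at this
  linarith

lemma integral_gaussianReal_of_odd {f : ℝ → ℝ} (hf : f.Odd) (v : NNReal) :
    ∫ x, f x ∂gaussianReal 0 v = 0 := by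
  have hmap : (gaussianReal 0 v).map (fun y => -y) = gaussianReal 0 v := by
    simpa using gaussianReal_map_neg (μ := 0) (v := v)
  have h : ∫ x, f x ∂gaussianReal 0 v = ∫ x, f (-x) ∂gaussianReal 0 v := by
    nth_rw 1 [← hmap]
    exact integral_map_equiv (MeasurableEquiv.neg ℝ) f
  simp_rw [hf _, integral_neg] at h
  linarith

lemma covP_indR_le_indR_sq_le {Ω : Type*} [MeasurableSpace Ω] {P : Measure Ω}
    {X : Ω → ℝ} (hX : Measurable X) (hlaw : Measure.map X P = gaussianReal 0 1)
    {τ₁ τ₂ a b : ℝ} (hτ₂ : 0 < τ₂) (ha : stdPhi a = τ₁) (hb : stdPhi b = (1 + τ₂) / 2) :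
    ((1 - τ₂) / 2 ≤ τ₁ ∧ τ₁ ≤ (1 + τ₂) / 2 →
        covP P (fun ω => indR (X ω ≤ a)) (fun ω => indR ((X ω) ^ 2 ≤ b ^ 2))
          = (1 - τ₂) * (τ₁ - 1 / 2)) ∧
      ((1 + τ₂) / 2 < τ₁ →
        covP P (fun ω => indR (X ω ≤ a)) (fun ω => indR ((X ω) ^ 2 ≤ b ^ 2))
          = τ₂ * (1 - τ₁)) ∧
      (τ₁ < (1 - τ₂) / 2 →
        covP P (fun ω => indR (X ω ≤ a)) (fun ω => indR ((X ω) ^ 2 ≤ b ^ 2))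
          = -(τ₁ * τ₂)) := by
  have hb₀ : 0 < b := stdPhi_strictMono.lt_iff_lt.1 (by rw [stdPhi_zero, hb]; linarith)
  have hnb : stdPhi (-b) = (1 - τ₂) / 2 := by rw [stdPhi_neg, hb]; ring
  have hcov : covP P (fun ω => indR (X ω ≤ a)) (fun ω => indR ((X ω) ^ 2 ≤ b ^ 2))
      = (gaussianReal 0 1).real (Set.Iic a ∩ Set.Icc (-b) b) - τ₁ * τ₂ := by
    have h := covP_indR_preimage (P := P) hX (measurableSet_Iic (a := a))
      (measurableSet_Icc (a := -b) (b := b))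
    simp only [Set.mem_Iic, Set.mem_Icc, ← abs_le, ← sq_le_sq₀ (abs_nonneg _) hb₀.le, sq_abs,
      hlaw] at h
    have h₁ : (gaussianReal 0 1).real (Set.Iic a) = τ₁ := ha
    rw [h, h₁, gaussianReal_real_Icc (by linarith), hb, hnb]
    ring
  rw [hcov]
  refine ⟨fun ⟨h₁, h₂⟩ => ?_, fun h => ?_, fun h => ?_⟩
  · have h₁' : -b ≤ a := stdPhi_strictMono.le_iff_le.1 (by rwa [hnb, ha])
    have h₂' : a ≤ b := stdPhi_strictMono.le_iff_le.1 (by rwa [hb, ha])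
    have hS : Set.Iic a ∩ Set.Icc (-b) b = Set.Icc (-b) a := by
      ext x; simp only [Set.mem_inter_iff, Set.mem_Iic, Set.mem_Icc]; grind
    rw [hS, gaussianReal_real_Icc h₁', ha, hnb]
    ring
  · have h' : b < a := stdPhi_strictMono.lt_iff_lt.1 (by rwa [hb, ha])
    have hS : Set.Iic a ∩ Set.Icc (-b) b = Set.Icc (-b) b := by
      ext x; simp only [Set.mem_inter_iff, Set.mem_Iic, Set.mem_Icc]; grind
    rw [hS, gaussianReal_real_Icc (by linarith), hb, hnb]
    ring
  · have h' : a < -b := stdPhi_strictMono.lt_iff_lt.1 (by rwa [hnb, ha])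
    have hS : Set.Iic a ∩ Set.Icc (-b) b = ∅ := by
      ext x; simp only [Set.mem_inter_iff, Set.mem_Iic, Set.mem_Icc, Set.mem_empty_iff_false]
      grind
    rw [hS, measureReal_empty]
    ring

/-- For a standard normal `X`, with `a = Φ⁻¹(τ₁)` and `b = Φ⁻¹((1+τ₂)/2)`, the covariance
`Cov(I{X ≤ a}, I{X² ≤ b²})` takes the stated piecewise values; it vanishes for all
`τ₂ ∈ (0,1)` if and only if `τ₁ = 1/2`, even though `Cov(X, X²) = 0`. -/
theorem gaussian_square_indicator_covariance
    {Ω : Type*} [MeasurableSpace Ω] (P : Measure Ω) [IsProbabilityMeasure P]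
    (X : Ω → ℝ) (hX : Measurable X) (hlaw : Measure.map X P = gaussianReal 0 1)
    (τ₁ τ₂ : ℝ) (hτ₁ : τ₁ ∈ Set.Ioo (0 : ℝ) 1) (hτ₂ : τ₂ ∈ Set.Ioo (0 : ℝ) 1)
    (a b : ℝ) (ha : stdPhi a = τ₁) (hb : stdPhi b = (1 + τ₂) / 2) :
    (((1 - τ₂) / 2 ≤ τ₁ ∧ τ₁ ≤ (1 + τ₂) / 2 →
        covP P (fun ω => indR (X ω ≤ a)) (fun ω => indR ((X ω) ^ 2 ≤ b ^ 2))
          = (1 - τ₂) * (τ₁ - 1 / 2)) ∧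
      ((1 + τ₂) / 2 < τ₁ →
        covP P (fun ω => indR (X ω ≤ a)) (fun ω => indR ((X ω) ^ 2 ≤ b ^ 2))
          = τ₂ * (1 - τ₁)) ∧
      (τ₁ < (1 - τ₂) / 2 →
        covP P (fun ω => indR (X ω ≤ a)) (fun ω => indR ((X ω) ^ 2 ≤ b ^ 2))
          = -(τ₁ * τ₂))) ∧
    ((∀ τ₂' ∈ Set.Ioo (0 : ℝ) 1, ∀ b' : ℝ, stdPhi b' = (1 + τ₂') / 2 →
        covP P (fun ω => indR (X ω ≤ a)) (fun ω => indR ((X ω) ^ 2 ≤ b' ^ 2)) = 0) ↔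
      τ₁ = 1 / 2) ∧
    covP P X (fun ω => (X ω) ^ 2) = 0 := by
  have hpiece := covP_indR_le_indR_sq_le hX hlaw hτ₂.1 ha hb
  refine ⟨hpiece, ⟨fun h => ?_, fun h τ hτ b' hb' => ?_⟩, ?_⟩
  · have h₀ := h τ₂ hτ₂ b hb
    obtain ⟨h₁, h₂, h₃⟩ := hpiece
    rw [h₀] at h₁ h₂ h₃
    rcases lt_or_ge τ₁ ((1 - τ₂) / 2) with hlo | hlo
    · have := mul_pos hτ₁.1 hτ₂.1
      linarith [h₃ hlo]
    rcases lt_or_ge ((1 + τ₂) / 2) τ₁ with hhi | hhi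
    · have := mul_pos hτ₂.1 (sub_pos.2 hτ₁.2)
      linarith [h₂ hhi]
    · have := (mul_eq_zero.1 (h₁ ⟨hlo, hhi⟩).symm).resolve_left (sub_pos.2 hτ₂.2).ne'
      linarith
  · have hτ₀ := hτ.1
    rw [(covP_indR_le_indR_sq_le hX hlaw hτ₀ ha hb').1 ⟨by linarith, by linarith⟩, h]
    ring
  · have h₁ : ∫ ω, X ω ∂P = 0 := by
      rw [← integral_map (f := fun x => x) hX.aemeasurable (by fun_prop), hlaw]
      exact integral_gaussianReal_of_odd (f := fun x => x) (fun _ => rfl) 1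
    have h₃ : ∫ ω, X ω * X ω ^ 2 ∂P = 0 := by
      rw [← integral_map (f := fun x => x * x ^ 2) hX.aemeasurable (by fun_prop), hlaw]
      exact integral_gaussianReal_of_odd (fun x => by ring) 1
    rw [covP, h₁, h₃]
    ring
end
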